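/- Let (f,ξ) be a classical solution of the Vlasov–Poisson system with point charge on [0,T], with the cutoff decomposition and backward flow (X,V) associated with a fixed t ∈ [0,T]. Let (τ,s) ∈ [0,t]², b > 0, and set ρ̃(τ,s,x) = ∫_{ℝ³} f(τ, X(s,x,v), V(s,x,v)) dv. Then ‖ρ̃(τ,s,·)‖_{L^{(b+3)/3}(ℝ³)} ≤ C(b) (1+s)^{3b/(3+b)} ‖f₀‖_{L∞}^{b/(3+b)} ( 1 + ∬_{ℝ³×ℝ³} |v|^b f(τ,x,v) dx dv )^{3/(3+b)}, where C(b) depends only on b. -/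

import Mathlib

open MeasureTheory Set Filter
open scoped ENNReal

noncomputable section

/-- Three-dimensional Euclidean space. -/
abbrev E3 : Type := EuclideanSpace ℝ (Fin 3)

/-- Spatial density `ρ(t,x) = ∫ f(t,x,v) dv`. -/
def rho (f : ℝ → E3 → E3 → ℝ) (t : ℝ) (x : E3) : ℝ := ∫ v : E3, f t x v

/-- Self-induced electric field `E(t,x) = ∫ (x-y)/|x-y|³ ρ(t,y) dy`. -/
def Efield (f : ℝ → E3 → E3 → ℝ) (t : ℝ) (x : E3) : E3 :=
  ∫ y : E3, (rho f t y / ‖x - y‖ ^ 3) • (x - y)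

/-- Singular field generated by the point charge located at `ξ t`:
`F(t,x) = (x-ξ(t))/|x-ξ(t)|³`. -/
def Fpt (ξ : ℝ → E3) (t : ℝ) (x : E3) : E3 := (‖x - ξ t‖ ^ 3)⁻¹ • (x - ξ t)

/-- Total mass `M(t) = ∬ f(t,x,v) dx dv`. -/
def mass (f : ℝ → E3 → E3 → ℝ) (t : ℝ) : ℝ := ∫ p : E3 × E3, f t p.1 p.2

/-- Total energy `𝓗(t)`. -/
def energy (f : ℝ → E3 → E3 → ℝ) (ξ η : ℝ → E3) (t : ℝ) : ℝ :=
    (1 / 2) * ∫ p : E3 × E3, ‖p.2‖ ^ 2 * f t p.1 p.2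
  + (1 / 2) * ‖η t‖ ^ 2
  + (1 / 2) * ∫ x : E3, ∫ y : E3, rho f t x * rho f t y / ‖x - y‖
  + ∫ x : E3, rho f t x / ‖x - ξ t‖

/-- `L^∞` norm of the initial datum `‖f₀‖_{L^∞}`. -/
def supf0 (f : ℝ → E3 → E3 → ℝ) : ℝ :=
  (eLpNorm (fun p : E3 × E3 => f 0 p.1 p.2) ⊤ volume).toReal

/-- A classical solution of the Vlasov–Poisson system with point charge on `[0,T]`:
`f` is a nonnegative `C¹` compactly supported density whose initial datum vanishes
in a neighborhood of the charge `ξ 0`, `ξ ∈ C²` with `ξ' = η`, `η' = E(t,ξ(t))`,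
and the Vlasov equation holds pointwise (away from the charge). -/
structure VPClassicalSolution (T : ℝ) where
  f : ℝ → E3 → E3 → ℝ
  ξ : ℝ → E3
  η : ℝ → E3
  T_pos : 0 < T
  f_nonneg : ∀ t x v, 0 ≤ f t x v
  f_c1 : ContDiff ℝ 1 (fun p : ℝ × E3 × E3 => f p.1 p.2.1 p.2.2)
  f_cpt : HasCompactSupport (fun p : ℝ × E3 × E3 => f p.1 p.2.1 p.2.2)
  f0_vanishes_near_charge : ∃ ε > 0, ∀ x v, ‖x - ξ 0‖ < ε → f 0 x v = 0
  ξ_c2 : ContDiff ℝ 2 ξ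
  ξ_ode : ∀ t, HasDerivAt ξ (η t) t
  η_ode : ∀ t ∈ Icc (0 : ℝ) T, HasDerivAt η (Efield f t (ξ t)) t
  vlasov : ∀ t ∈ Icc (0 : ℝ) T, ∀ x v, x ≠ ξ t →
      deriv (fun τ : ℝ => f τ x v) t
      + fderiv ℝ (fun y : E3 => f t y v) x v
      + fderiv ℝ (fun w : E3 => f t x w) v (Efield f t x + Fpt ξ t x) = 0

/-- The microscopic energy function
`h(t,x,v) = |v-η(t)|²/2 + 1/|x-ξ(t)| + 𝓗(0) + M₀⁻¹ + 1`. -/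
def hEnergy (f : ℝ → E3 → E3 → ℝ) (ξ η : ℝ → E3) (t : ℝ) (x v : E3) : ℝ :=
  ‖v - η t‖ ^ 2 / 2 + ‖x - ξ t‖⁻¹ + energy f ξ η 0 + (mass f 0)⁻¹ + 1

/-- The energy moment `H̃_k(t) = ∬ h(t,x,v)^{k/2} f(t,x,v) dx dv`. -/
def Htilde (f : ℝ → E3 → E3 → ℝ) (ξ η : ℝ → E3) (k t : ℝ) : ℝ :=
  ∫ p : E3 × E3, hEnergy f ξ η t p.1 p.2 ^ (k / 2) * f t p.1 p.2

/-- The running supremum of the energy moments `H_k(t) = sup_{0≤s≤t} H̃_k(s)`. -/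
def Hmom (f : ℝ → E3 → E3 → ℝ) (ξ η : ℝ → E3) (k t : ℝ) : ℝ :=
  sSup (Htilde f ξ η k '' Icc 0 t)

/-- Data of a smooth cutoff function `χ₀` together with the constant `K₀ ≥ 100`. -/
structure CutoffData where
  χ : E3 → ℝ
  K0 : ℝ
  K0_ge : 100 ≤ K0
  smooth : ContDiff ℝ (⊤ : ℕ∞) χ
  mem_Icc : ∀ z, χ z ∈ Icc (0 : ℝ) 1
  eq_one : ∀ z, ‖z‖ ≤ 1 → χ z = 1
  eq_zero : ∀ z, 2 ≤ ‖z‖ → χ z = 0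
  grad_le : ∀ z, ‖fderiv ℝ χ z‖ ≤ 2
  hess_le : ∀ z, ‖fderiv ℝ (fderiv ℝ χ) z‖ ≤ 20

/-- The cutoff radius `R = (24 K₀ (1+‖f₀‖_{L¹}))^{1/3} (1+T)`. -/
def Rcut (T : ℝ) (f : ℝ → E3 → E3 → ℝ) (K0 : ℝ) : ℝ :=
  (24 * K0 * (1 + mass f 0)) ^ ((1 : ℝ) / 3) * (1 + T)

/-- The rescaled cutoff `χ_R(z) = χ₀(z/R)`. -/
def chiR (T : ℝ) (f : ℝ → E3 → E3 → ℝ) (c : CutoffData) (z : E3) : ℝ :=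
  c.χ ((Rcut T f c.K0)⁻¹ • z)

/-- Internal part of the self-induced field: `E_int = ρ ∗ (χ_R(x) x/|x|³)`. -/
def Eint (T : ℝ) (f : ℝ → E3 → E3 → ℝ) (c : CutoffData) (t : ℝ) (x : E3) : E3 :=
  ∫ y : E3, (chiR T f c (x - y) * rho f t y / ‖x - y‖ ^ 3) • (x - y)

/-- Internal part of the point-charge field: `F_int(t,x) = F(t,x) χ_R(x-ξ(t))`. -/
def Fint (T : ℝ) (f : ℝ → E3 → E3 → ℝ) (ξ : ℝ → E3) (c : CutoffData) (t : ℝ) (x : E3) : E3 :=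
  chiR T f c (x - ξ t) • Fpt ξ t x

/-- External part of the self-induced field. -/
def Eext (T : ℝ) (f : ℝ → E3 → E3 → ℝ) (c : CutoffData) (t : ℝ) (x : E3) : E3 :=
  Efield f t x - Eint T f c t x

/-- External part of the point-charge field. -/
def Fext (T : ℝ) (f : ℝ → E3 → E3 → ℝ) (ξ : ℝ → E3) (c : CutoffData) (t : ℝ) (x : E3) : E3 :=
  Fpt ξ t x - Fint T f ξ c t x

/-- The backward flow of the field `E_ext + F_ext` associated with the time `t`:
`dX/ds = -V`, `dV/ds = -(E_ext+F_ext)(t-s, X)`, `(X,V)(0,x,v) = (x,v)`. -/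
structure BackwardFlow (T : ℝ) (S : VPClassicalSolution T) (c : CutoffData) (t : ℝ) where
  X : ℝ → E3 → E3 → E3
  V : ℝ → E3 → E3 → E3
  init_X : ∀ x v, X 0 x v = x
  init_V : ∀ x v, V 0 x v = v
  ode_X : ∀ x v, ∀ s ∈ Icc (0 : ℝ) t, HasDerivAt (fun s => X s x v) (-(V s x v)) s
  ode_V : ∀ x v, ∀ s ∈ Icc (0 : ℝ) t, HasDerivAt (fun s => V s x v)
      (-(Eext T S.f c (t - s) (X s x v) + Fext T S.f S.ξ c (t - s) (X s x v))) s

/-- The Duhamel term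
`x ↦ ∫₀ᵗ s ∫ (|E_int + F_int| f)(t-s, X(s,x,v), V(s,x,v)) dv ds`. -/
def Dterm (T : ℝ) (S : VPClassicalSolution T) (c : CutoffData) (t : ℝ)
    (Φ : BackwardFlow T S c t) (x : E3) : ℝ :=
  ∫ s in (0 : ℝ)..t, s * ∫ v : E3,
    ‖Eint T S.f c (t - s) (Φ.X s x v) + Fint T S.f S.ξ c (t - s) (Φ.X s x v)‖
      * S.f (t - s) (Φ.X s x v) (Φ.V s x v)

/-- Symplectic Euler scheme of step `h` for `dx/ds = -v`, `dv/ds = -G(s,x)`. -/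
def symplecticEuler (G : ℝ → E3 → E3) (h : ℝ) : ℕ → E3 × E3 → E3 × E3
  | 0, z => z
  | k + 1, z =>
    ((symplecticEuler G h k z).1 - h • (symplecticEuler G h k z).2,
      (symplecticEuler G h k z).2 -
        h • G ((k + 1 : ℕ) * h)
          ((symplecticEuler G h k z).1 - h • (symplecticEuler G h k z).2))

theorem measurePreserving_shear_snd {g : E3 → E3} (hg : Continuous g) :
    MeasurePreserving (fun p : E3 × E3 => (p.1, p.2 - g p.1)) := by
  refine (MeasurePreserving.id (volume : Measure E3)).skew_product
    (g := fun x v => v - g x) (μc := volume) (μd := volume) ?_ ?_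
  · exact (continuous_snd.sub (hg.comp continuous_fst)).measurable
  · exact ae_of_all _ fun x => (measurePreserving_sub_right volume (g x)).map_eq

theorem measurePreserving_shear_fst {g : E3 → E3} (hg : Continuous g) :
    MeasurePreserving (fun p : E3 × E3 => (p.1 - g p.2, p.2)) :=
  (Measure.measurePreserving_swap.comp (measurePreserving_shear_snd hg)).comp
    Measure.measurePreserving_swap

theorem measurePreserving_symplecticEuler {G : ℝ → E3 → E3} (hG : ∀ s, Continuous (G s)) (h : ℝ)
    (k : ℕ) : MeasurePreserving (symplecticEuler G h k) := by
  induction k with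
  | zero => exact MeasurePreserving.id _
  | succ k ih =>
    exact ((measurePreserving_shear_snd (g := fun x => h • G ((k + 1 : ℕ) * h) x)
      ((hG _).const_smul h)).comp
      (measurePreserving_shear_fst (g := fun v => h • v) (continuous_id.const_smul h))).comp ih

/-- A differentiable curve with almost constant velocity is almost affine. -/
theorem norm_sub_sub_smul_le {Y Y' : ℝ → E3} {a b ε : ℝ} {w : E3} (hab : a ≤ b)
    (hY : ∀ u ∈ Icc a b, HasDerivAt Y (Y' u) u) (hw : ∀ u ∈ Icc a b, ‖Y' u - w‖ ≤ ε) :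
    ‖Y b - Y a - (b - a) • w‖ ≤ ε * (b - a) := by
  have key := (convex_Icc a b).norm_image_sub_le_of_norm_hasDerivWithin_le
    (f := fun u => Y u - u • w) (f' := fun u => Y' u - w) (C := ε) (x := a) (y := b)
    (fun u hu => by
      have h := ((hasDerivAt_id u).smul_const w)
      rw [one_smul] at h
      exact ((hY u hu).sub h).hasDerivWithinAt)
    hw (left_mem_Icc.2 hab) (right_mem_Icc.2 hab)
  rw [Real.norm_of_nonneg (sub_nonneg.2 hab)] at key
  rwa [show Y b - Y a - (b - a) • w = (Y b - b • w) - (Y a - a • w) by module]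

/-- Discrete Gronwall estimate for the global error of the symplectic Euler scheme. -/
theorem symplecticEuler_error {G : ℝ → E3 → E3} {L s h ε : ℝ} {n : ℕ} (hL : 0 ≤ L) (hh : 0 ≤ h)
    (hε : 0 ≤ ε) (hns : n * h = s)
    (hLip : ∀ u ∈ Icc 0 s, ∀ x y, ‖G u x - G u y‖ ≤ L * ‖x - y‖)
    {X V : ℝ → E3} (hX : ∀ u ∈ Icc 0 s, HasDerivAt X (-V u) u)
    (hV : ∀ u ∈ Icc 0 s, HasDerivAt V (-G u (X u)) u)
    (hmodV : ∀ u ∈ Icc 0 s, ∀ u' ∈ Icc 0 s, |u - u'| ≤ h → ‖V u - V u'‖ ≤ ε)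
    (hmodG : ∀ u ∈ Icc 0 s, ∀ u' ∈ Icc 0 s, |u - u'| ≤ h → ‖G u (X u) - G u' (X u')‖ ≤ ε)
    (k : ℕ) (hk : k ≤ n) :
    ‖(symplecticEuler G h k (X 0, V 0)).1 - X (k * h)‖ +
      ‖(symplecticEuler G h k (X 0, V 0)).2 - V (k * h)‖ ≤
        Real.exp (k * h * (L + 1)) * (2 * (k * h) * ε) := by
  induction k with
  | zero => simp [symplecticEuler]
  | succ k ih =>
    specialize ih (by omega)
    set x := (symplecticEuler G h k (X 0, V 0)).1 with hx
    set v := (symplecticEuler G h k (X 0, V 0)).2 with hv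
    set a : ℝ := k * h with ha
    set b : ℝ := (k + 1 : ℕ) * h with hb
    have hba : b - a = h := by rw [hb, ha]; push_cast; ring
    have ha0 : 0 ≤ a := by positivity
    have hab : a ≤ b := by linarith
    have hbs : b ≤ s := by
      rw [← hns, hb]; gcongr
    have hsub : Icc a b ⊆ Icc 0 s := Icc_subset_Icc ha0 hbs
    have hclose : ∀ u ∈ Icc a b, |u - a| ≤ h ∧ |u - b| ≤ h := fun u hu => by
      constructor <;> rw [abs_le] <;> constructor <;> linarith [hu.1, hu.2]
    have haI := hsub (left_mem_Icc.2 hab)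
    have hbI := hsub (right_mem_Icc.2 hab)
    have eX : ‖X b - X a - h • (-V a)‖ ≤ ε * h := by
      rw [← hba]
      refine norm_sub_sub_smul_le hab (fun u hu => hX u (hsub hu)) fun u hu => ?_
      rw [show -V u - -V a = -(V u - V a) by abel, norm_neg]
      exact hmodV u (hsub hu) a haI (hclose u hu).1
    have eV : ‖V b - V a - h • (-G b (X b))‖ ≤ ε * h := by
      rw [← hba]
      refine norm_sub_sub_smul_le hab (fun u hu => hV u (hsub hu)) fun u hu => ?_
      rw [show -G u (X u) - -G b (X b) = -(G u (X u) - G b (X b)) by abel, norm_neg]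
      exact hmodG u (hsub hu) b hbI (hclose u hu).2
    have e1 : ‖(x - h • v) - X b‖ ≤ ‖x - X a‖ + h * ‖v - V a‖ + ε * h := by
      have : (x - h • v) - X b = (x - X a) - h • (v - V a) - (X b - X a - h • (-V a)) := by module
      rw [this]
      refine (norm_sub_le _ _).trans (add_le_add ((norm_sub_le _ _).trans ?_) eX)
      rw [norm_smul, Real.norm_of_nonneg hh]
    have e2 : ‖(v - h • G b (x - h • v)) - V b‖ ≤
        ‖v - V a‖ + h * (L * ‖(x - h • v) - X b‖) + ε * h := by
      have : (v - h • G b (x - h • v)) - V b =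
          (v - V a) - h • (G b (x - h • v) - G b (X b)) - (V b - V a - h • (-G b (X b))) := by
        module
      rw [this]
      refine (norm_sub_le _ _).trans (add_le_add ((norm_sub_le _ _).trans ?_) eV)
      rw [norm_smul, Real.norm_of_nonneg hh]
      gcongr
      exact hLip b hbI _ _
    change ‖(x - h • v) - X b‖ + ‖(v - h • G b (x - h • v)) - V b‖ ≤ _
    set A := ‖x - X a‖
    set B := ‖v - V a‖
    have hA : 0 ≤ A := norm_nonneg _
    have hB : 0 ≤ B := norm_nonneg _
    have hexp : (1 + h * L) * (1 + h) ≤ Real.exp (h * (L + 1)) := by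
      rw [mul_add h L 1, Real.exp_add, mul_one]
      have h1 := Real.add_one_le_exp (h * L)
      have h2 := Real.add_one_le_exp h
      gcongr <;> linarith
    have step : ‖(x - h • v) - X b‖ + ‖(v - h • G b (x - h • v)) - V b‖ ≤
        (1 + h * L) * (1 + h) * (A + B + 2 * h * ε) := by
      have hhL : 0 ≤ h * L := by positivity
      have : ‖(x - h • v) - X b‖ + ‖(v - h • G b (x - h • v)) - V b‖ ≤
          (1 + h * L) * (A + h * B + ε * h) + (B + ε * h) := by nlinarith
      have h3 : 0 ≤ h * A + 2 * h * h * ε := by positivity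
      have h4 : 0 ≤ h * L * (B + ε * h) := by positivity
      have h5 : 0 ≤ (1 + h * L) * (h * A + 2 * h * h * ε) := by positivity
      nlinarith
    have hexp1 : 1 ≤ Real.exp (a * (L + 1)) := Real.one_le_exp (by positivity)
    have hbe : Real.exp (b * (L + 1)) = Real.exp (h * (L + 1)) * Real.exp (a * (L + 1)) := by
      rw [← Real.exp_add]; congr 1; rw [← hba]; ring
    calc _ ≤ (1 + h * L) * (1 + h) * (A + B + 2 * h * ε) := step
      _ ≤ Real.exp (h * (L + 1)) *
          (Real.exp (a * (L + 1)) * (2 * a * ε) + Real.exp (a * (L + 1)) * (2 * h * ε)) := by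
        have h6 : 2 * h * ε ≤ Real.exp (a * (L + 1)) * (2 * h * ε) :=
          le_mul_of_one_le_left (by positivity) hexp1
        exact mul_le_mul hexp (add_le_add ih h6) (by positivity) (Real.exp_nonneg _)
      _ = Real.exp (b * (L + 1)) * (2 * b * ε) := by
        rw [hbe, ← hba]; ring

/-- The symplectic Euler scheme converges to the trajectories of `dx/ds = -v`, `dv/ds = -G(s,x)`. -/
theorem tendsto_symplecticEuler {G : ℝ → E3 → E3} {L s : ℝ} (hL : 0 ≤ L) (hs : 0 ≤ s)
    (hG : Continuous (Function.uncurry G))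
    (hLip : ∀ u ∈ Icc 0 s, ∀ x y, ‖G u x - G u y‖ ≤ L * ‖x - y‖)
    {X V : ℝ → E3} (hX : ∀ u ∈ Icc 0 s, HasDerivAt X (-V u) u)
    (hV : ∀ u ∈ Icc 0 s, HasDerivAt V (-G u (X u)) u) :
    Tendsto (fun n : ℕ => symplecticEuler G (s / (n + 1)) (n + 1) (X 0, V 0)) atTop
      (nhds (X s, V s)) := by
  have cX : ContinuousOn X (Icc 0 s) := fun u hu => (hX u hu).continuousAt.continuousWithinAt
  have cV : ContinuousOn V (Icc 0 s) := fun u hu => (hV u hu).continuousAt.continuousWithinAt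
  have cG : ContinuousOn (fun u => G u (X u)) (Icc 0 s) :=
    hG.comp_continuousOn (continuousOn_id.prodMk cX)
  have uV := Metric.uniformContinuousOn_iff_le.1 (isCompact_Icc.uniformContinuousOn_of_continuous cV)
  have uG := Metric.uniformContinuousOn_iff_le.1 (isCompact_Icc.uniformContinuousOn_of_continuous cG)
  rw [Metric.tendsto_atTop]
  intro δ hδ
  set K := Real.exp (s * (L + 1)) * (2 * s) with hK
  have hK0 : 0 ≤ K := by positivity
  set ε := δ / (2 * (K + 1)) with hεd
  have hε : 0 < ε := by positivity
  obtain ⟨δ₁, hδ₁, h₁⟩ := uV ε hε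
  obtain ⟨δ₂, hδ₂, h₂⟩ := uG ε hε
  have hlim : Tendsto (fun n : ℕ => s / ((n : ℝ) + 1)) atTop (nhds 0) := by
    simpa [div_eq_mul_inv] using (tendsto_one_div_add_atTop_nhds_zero_nat (𝕜 := ℝ)).const_mul s
  obtain ⟨N, hN⟩ := eventually_atTop.1 (hlim.eventually_lt_const (lt_min hδ₁ hδ₂))
  refine ⟨N, fun n hn => ?_⟩
  have hh := hN n hn
  have hn0 : ((n + 1 : ℕ) : ℝ) * (s / ((n : ℝ) + 1)) = s := by
    push_cast; field_simp
  have err := symplecticEuler_error hL (by positivity) hε.le hn0 hLip hX hV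
    (fun u hu u' hu' h => by
      rw [← dist_eq_norm]
      exact h₁ u hu u' hu' (by rw [Real.dist_eq]; exact h.trans (hh.le.trans (min_le_left _ _))))
    (fun u hu u' hu' h => by
      rw [← dist_eq_norm]
      exact h₂ u hu u' hu' (by rw [Real.dist_eq]; exact h.trans (hh.le.trans (min_le_right _ _))))
    (n + 1) le_rfl
  rw [hn0] at err
  have hfin : Real.exp (s * (L + 1)) * (2 * s * ε) < δ := by
    have : Real.exp (s * (L + 1)) * (2 * s * ε) = K * ε := by rw [hK]; ring
    rw [this, hεd, ← mul_div_assoc, div_lt_iff₀ (by positivity)]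
    nlinarith
  rw [Prod.dist_eq, dist_eq_norm, dist_eq_norm]
  refine lt_of_le_of_lt (max_le ?_ ?_) (err.trans_lt hfin)
  · exact le_add_of_nonneg_right (norm_nonneg _)
  · exact le_add_of_nonneg_left (norm_nonneg _)

/-- Flow of `dx/ds = -v`, `dv/ds = -G(s,x)`: measurability and (one-sided) invariance of Lebesgue
measure. -/
theorem lintegral_comp_flow_le {G : ℝ → E3 → E3} {L s : ℝ} (hL : 0 ≤ L) (hs : 0 ≤ s)
    (hG : Continuous (Function.uncurry G))
    (hLip : ∀ u ∈ Icc 0 s, ∀ x y, ‖G u x - G u y‖ ≤ L * ‖x - y‖)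
    {X V : ℝ → E3 → E3 → E3} (hX0 : ∀ x v, X 0 x v = x) (hV0 : ∀ x v, V 0 x v = v)
    (hX : ∀ x v, ∀ u ∈ Icc 0 s, HasDerivAt (fun u => X u x v) (-V u x v) u)
    (hV : ∀ x v, ∀ u ∈ Icc 0 s, HasDerivAt (fun u => V u x v) (-G u (X u x v)) u) :
    Measurable (fun p : E3 × E3 => (X s p.1 p.2, V s p.1 p.2)) ∧
      ∀ g : E3 × E3 → ℝ≥0∞, Continuous g →
        ∫⁻ p : E3 × E3, g (X s p.1 p.2, V s p.1 p.2) ≤ ∫⁻ p : E3 × E3, g p := by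
  set T : ℕ → E3 × E3 → E3 × E3 := fun n => symplecticEuler G (s / (n + 1)) (n + 1)
  have hTmp : ∀ n, MeasurePreserving (T n) := fun n =>
    measurePreserving_symplecticEuler (fun s => by fun_prop) _ _
  have hT : ∀ p : E3 × E3, Tendsto (fun n => T n p) atTop (nhds (X s p.1 p.2, V s p.1 p.2)) := by
    rintro ⟨x, v⟩
    simpa only [hX0, hV0] using tendsto_symplecticEuler hL hs hG hLip (hX x v) (hV x v)
  refine ⟨measurable_of_tendsto_metrizable (fun n => (hTmp n).measurable) (tendsto_pi_nhds.2 hT),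
    fun g hg => ?_⟩
  calc ∫⁻ p : E3 × E3, g (X s p.1 p.2, V s p.1 p.2)
      = ∫⁻ p : E3 × E3, liminf (fun n => g (T n p)) atTop := by
        refine lintegral_congr fun p => ?_
        exact ((hg.tendsto _).comp (hT p)).liminf_eq.symm
    _ ≤ liminf (fun n => ∫⁻ p : E3 × E3, g (T n p)) atTop :=
        lintegral_liminf_le fun n => hg.measurable.comp (hTmp n).measurable
    _ = ∫⁻ p : E3 × E3, g p := by
        simp only [fun n => (hTmp n).lintegral_comp hg.measurable, liminf_const]

/-- The fundamental theorem of calculus for a compactly supported function. -/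
theorem integral_fderiv_apply_eq_zero {g : E3 → ℝ} (hg : ContDiff ℝ 1 g) (hc : HasCompactSupport g)
    (w : E3) : ∫ x, fderiv ℝ g x w = 0 := by
  have hfd : Integrable (fun x => fderiv ℝ g x w) :=
    ((hg.continuous_fderiv one_ne_zero).clm_apply continuous_const).integrable_of_hasCompactSupport
      (hc.fderiv_apply ℝ w)
  have key := integral_mul_fderiv_eq_neg_fderiv_mul_of_integrable (μ := (volume : Measure E3))
    (f := fun _ => (1 : ℝ)) (g := g) (v := w) (by simp) (by simpa using hfd)
    (by simpa using hg.continuous.integrable_of_hasCompactSupport hc)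
    (fun x _ => differentiableAt_const _) (fun x _ => hg.differentiable one_ne_zero x)
  simpa using key

/-- The kernel `|z|⁻²`, truncated to the unit ball, is integrable in dimension three. -/
theorem integrable_truncated_inv_sq :
    Integrable (fun z : E3 => (Iio (1 : ℝ)).indicator (fun r => (r ^ 2)⁻¹) ‖z‖) := by
  rw [integrable_fun_norm_addHaar (μ := (volume : Measure E3))
    (f := (Iio (1 : ℝ)).indicator (fun r => (r ^ 2)⁻¹))]
  have h : IntegrableOn ((Iio (1 : ℝ)).indicator (fun _ => (1 : ℝ))) (Ioi 0) := by
    rw [IntegrableOn, integrable_indicator_iff measurableSet_Iio, IntegrableOn,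
      Measure.restrict_restrict measurableSet_Iio]
    refine integrableOn_const ?_
    rw [inter_comm, Ioi_inter_Iio]
    simp
  refine h.congr_fun (fun r hr => ?_) measurableSet_Ioi
  have hr' : r ≠ 0 := (mem_Ioi.1 hr).ne'
  by_cases h1 : r < 1
  · simp [h1, hr']
  · simp [h1]

theorem integrable_coulomb {ρ : E3 → ℝ} (hρ : Continuous ρ) (hc : HasCompactSupport ρ) :
    (∀ x, Integrable (fun y => (ρ y / ‖x - y‖ ^ 3) • (x - y))) ∧
      ∃ B, ∀ x, ‖∫ y, (ρ y / ‖x - y‖ ^ 3) • (x - y)‖ ≤ B := by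
  obtain ⟨M, hM⟩ := hc.exists_bound_of_continuous hρ
  have hM0 : 0 ≤ M := (norm_nonneg _).trans (hM 0)
  set k : E3 → ℝ := fun z => (Iio (1 : ℝ)).indicator (fun r => (r ^ 2)⁻¹) ‖z‖ with hk
  have hρi : Integrable (fun y => ‖ρ y‖) := (hρ.integrable_of_hasCompactSupport hc).norm
  have hki : ∀ x, Integrable (fun y => M * k (x - y)) := fun x =>
    (integrable_truncated_inv_sq.comp_sub_left x).const_mul M
  have hbound : ∀ x y, ‖(ρ y / ‖x - y‖ ^ 3) • (x - y)‖ ≤ M * k (x - y) + ‖ρ y‖ := by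
    intro x y
    have e : ‖(ρ y / ‖x - y‖ ^ 3) • (x - y)‖ = ‖ρ y‖ * (‖x - y‖ ^ 2)⁻¹ := by
      rw [norm_smul, norm_div, norm_pow, norm_norm]
      rcases eq_or_ne ‖x - y‖ 0 with h | h
      · simp [h]
      · field_simp
    rw [e]
    by_cases h1 : ‖x - y‖ < 1
    · have : k (x - y) = (‖x - y‖ ^ 2)⁻¹ := by simp [hk, h1]
      rw [this]
      have := mul_le_mul_of_nonneg_right (hM y) (inv_nonneg.2 (sq_nonneg ‖x - y‖))
      linarith [norm_nonneg (ρ y)]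
    · have : k (x - y) = 0 := by simp [hk, h1]
      rw [this, mul_zero, zero_add]
      exact mul_le_of_le_one_right (norm_nonneg _)
        (inv_le_one_of_one_le₀ (one_le_pow₀ (not_lt.1 h1)))
  have hmeas : ∀ x, AEStronglyMeasurable (fun y => (ρ y / ‖x - y‖ ^ 3) • (x - y)) := fun x => by
    have := hρ.measurable
    exact Measurable.aestronglyMeasurable (by fun_prop)
  refine ⟨fun x => ((hki x).add hρi).mono' (hmeas x) (ae_of_all _ (hbound x)),
    M * (∫ z, k z) + ∫ y, ‖ρ y‖, fun x => ?_⟩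
  refine (norm_integral_le_of_norm_le ((hki x).add hρi) (ae_of_all _ (hbound x))).trans_eq ?_
  have : ∫ y, (M * k (x - y) + ‖ρ y‖) = (∫ y, M * k (x - y)) + ∫ y, ‖ρ y‖ :=
    integral_add (hki x) hρi
  exact this.trans (by rw [integral_const_mul, integral_sub_left_eq_self])

namespace VPClassicalSolution

variable {T : ℝ} (S : VPClassicalSolution T)

/-- The total derivative of the density. -/
def df (p : ℝ × E3 × E3) : ℝ × E3 × E3 →L[ℝ] ℝ :=
  fderiv ℝ (fun p : ℝ × E3 × E3 => S.f p.1 p.2.1 p.2.2) p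

theorem hasFDerivAt_f (p : ℝ × E3 × E3) :
    HasFDerivAt (fun p : ℝ × E3 × E3 => S.f p.1 p.2.1 p.2.2) (S.df p) p :=
  (S.f_c1.differentiable one_ne_zero p).hasFDerivAt

theorem continuous_df : Continuous S.df := S.f_c1.continuous_fderiv one_ne_zero

theorem hasDerivAt_time (t : ℝ) (x v : E3) :
    HasDerivAt (fun τ => S.f τ x v) (S.df (t, x, v) (1, 0, 0)) t :=
  (S.hasFDerivAt_f (t, x, v)).comp_hasDerivAt t
    (f := fun τ : ℝ => (τ, x, v)) ((hasDerivAt_id t).prodMk (hasDerivAt_const t (x, v)))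

theorem hasFDerivAt_space (t : ℝ) (x v : E3) :
    HasFDerivAt (fun y => S.f t y v)
      ((S.df (t, x, v)).comp ((ContinuousLinearMap.inr ℝ ℝ (E3 × E3)).comp
        (ContinuousLinearMap.inl ℝ E3 E3))) x :=
  (S.hasFDerivAt_f (t, x, v)).comp x (f := fun y : E3 => (t, y, v))
    ((hasFDerivAt_prodMk_right t (x, v)).comp x (hasFDerivAt_prodMk_left x v))

theorem hasFDerivAt_velocity (t : ℝ) (x v : E3) :
    HasFDerivAt (fun w => S.f t x w)
      ((S.df (t, x, v)).comp ((ContinuousLinearMap.inr ℝ ℝ (E3 × E3)).comp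
        (ContinuousLinearMap.inr ℝ E3 E3))) v :=
  (S.hasFDerivAt_f (t, x, v)).comp v (f := fun w : E3 => (t, x, w))
    ((hasFDerivAt_prodMk_right t (x, v)).comp v (hasFDerivAt_prodMk_right x v))

theorem fderiv_space_apply (t : ℝ) (x v w : E3) :
    fderiv ℝ (fun y => S.f t y v) x w = S.df (t, x, v) (0, w, 0) := by
  rw [(S.hasFDerivAt_space t x v).fderiv]; rfl

theorem fderiv_velocity_apply (t : ℝ) (x v w : E3) :
    fderiv ℝ (fun y => S.f t x y) v w = S.df (t, x, v) (0, 0, w) := by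
  rw [(S.hasFDerivAt_velocity t x v).fderiv]; rfl

/-- The Vlasov equation in terms of the total derivative. -/
theorem vlasov_df {t : ℝ} (ht : t ∈ Icc 0 T) {x : E3} (v : E3) (hx : x ≠ S.ξ t) :
    S.df (t, x, v) (1, 0, 0) + S.df (t, x, v) (0, v, 0)
      + S.df (t, x, v) (0, 0, Efield S.f t x + Fpt S.ξ t x) = 0 := by
  rw [← S.fderiv_space_apply, ← S.fderiv_velocity_apply, ← (S.hasDerivAt_time t x v).deriv]
  exact S.vlasov t ht x v hx

theorem continuous_f : Continuous (fun p : ℝ × E3 × E3 => S.f p.1 p.2.1 p.2.2) :=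
  S.f_c1.continuous

theorem exists_support_radius : ∃ R : ℝ, ∀ t x v, R < ‖(t, x, v)‖ →
    S.f t x v = 0 ∧ S.df (t, x, v) = 0 := by
  obtain ⟨R, hR⟩ := S.f_cpt.isCompact.isBounded.subset_closedBall 0
  refine ⟨R, fun t x v h => ?_⟩
  have hn : (t, x, v) ∉ tsupport (fun p : ℝ × E3 × E3 => S.f p.1 p.2.1 p.2.2) := fun hm => by
    have := hR hm
    rw [mem_closedBall_zero_iff] at this
    linarith
  refine ⟨image_eq_zero_of_notMem_tsupport
    (f := fun p : ℝ × E3 × E3 => S.f p.1 p.2.1 p.2.2) hn, ?_⟩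
  exact image_eq_zero_of_notMem_tsupport (fun h => hn (tsupport_fderiv_subset ℝ h))

theorem exists_bound_df : ∃ B, ∀ p, ‖S.df p‖ ≤ B :=
  (S.f_cpt.fderiv ℝ).exists_bound_of_continuous S.continuous_df

theorem norm_snd_le (t : ℝ) (p : E3 × E3) : ‖p‖ ≤ ‖(t, p)‖ := le_max_right _ _

theorem hasCompactSupport_phase (t : ℝ) :
    HasCompactSupport (fun p : E3 × E3 => S.f t p.1 p.2) := by
  obtain ⟨R, hR⟩ := S.exists_support_radius
  refine HasCompactSupport.intro (isCompact_closedBall 0 R) fun p hp => ?_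
  rw [mem_closedBall_zero_iff, not_le] at hp
  exact (hR t p.1 p.2 (hp.trans_le (norm_snd_le t p))).1

theorem continuous_phase (t : ℝ) : Continuous (fun p : E3 × E3 => S.f t p.1 p.2) :=
  S.continuous_f.comp (Continuous.prodMk_right t)

theorem integrable_phase (t : ℝ) : Integrable (fun p : E3 × E3 => S.f t p.1 p.2) :=
  (S.continuous_phase t).integrable_of_hasCompactSupport (S.hasCompactSupport_phase t)

theorem hasCompactSupport_velocity (t : ℝ) (x : E3) : HasCompactSupport (fun v => S.f t x v) := by
  obtain ⟨R, hR⟩ := S.exists_support_radius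
  refine HasCompactSupport.intro (isCompact_closedBall 0 R) fun v hv => ?_
  rw [mem_closedBall_zero_iff, not_le] at hv
  exact (hR t x v (hv.trans_le ((le_max_right _ _).trans (norm_snd_le t (x, v))))).1

theorem hasCompactSupport_space (t : ℝ) (v : E3) : HasCompactSupport (fun x => S.f t x v) := by
  obtain ⟨R, hR⟩ := S.exists_support_radius
  refine HasCompactSupport.intro (isCompact_closedBall 0 R) fun x hx => ?_
  rw [mem_closedBall_zero_iff, not_le] at hx
  exact (hR t x v (hx.trans_le ((le_max_left _ _).trans (norm_snd_le t (x, v))))).1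

theorem exists_rho_support :
    ∃ R : ℝ, ∀ t x, R < ‖x‖ → rho S.f t x = 0 := by
  obtain ⟨R, hR⟩ := S.exists_support_radius
  refine ⟨R, fun t x hx => ?_⟩
  have : ∀ v, S.f t x v = 0 := fun v =>
    (hR t x v (hx.trans_le ((le_max_left _ _).trans (norm_snd_le t (x, v))))).1
  simp [rho, this]

theorem hasCompactSupport_rho (t : ℝ) : HasCompactSupport (rho S.f t) := by
  obtain ⟨R, hR⟩ := S.exists_rho_support
  refine HasCompactSupport.intro (isCompact_closedBall 0 R) fun x hx => ?_
  rw [mem_closedBall_zero_iff, not_le] at hx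
  exact hR t x hx

theorem continuous_rho : Continuous (fun p : ℝ × E3 => rho S.f p.1 p.2) := by
  obtain ⟨R, hR⟩ := S.exists_support_radius
  have e : (fun p : ℝ × E3 => rho S.f p.1 p.2) =
      fun p : ℝ × E3 => ∫ v in Metric.closedBall (0 : E3) R, S.f p.1 p.2 v := by
    funext p
    refine (setIntegral_eq_integral_of_forall_compl_eq_zero fun v hv => ?_).symm
    rw [mem_closedBall_zero_iff, not_le] at hv
    exact (hR p.1 p.2 v (hv.trans_le ((le_max_right _ _).trans (norm_snd_le p.1 (p.2, v))))).1
  rw [e]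
  refine continuous_parametric_integral_of_continuous
    (f := fun (p : ℝ × E3) v => S.f p.1 p.2 v) ?_ (isCompact_closedBall 0 R)
  exact S.continuous_f.comp
    (g := fun p : ℝ × E3 × E3 => S.f p.1 p.2.1 p.2.2)
    (f := fun q : (ℝ × E3) × E3 => (q.1.1, q.1.2, q.2)) (by fun_prop)

theorem continuous_rho_slice (t : ℝ) : Continuous (rho S.f t) :=
  S.continuous_rho.comp (Continuous.prodMk_right t)

theorem rho_nonneg (t : ℝ) (x : E3) : 0 ≤ rho S.f t x :=
  integral_nonneg fun v => S.f_nonneg t x v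

theorem integral_rho (t : ℝ) : ∫ x, rho S.f t x = mass S.f t :=
  (integral_prod _ (S.integrable_phase t)).symm

theorem mass_nonneg (t : ℝ) : 0 ≤ mass S.f t :=
  integral_nonneg fun p => S.f_nonneg t p.1 p.2

/-- The density vanishes at the location of the charge. -/
theorem f_at_charge {t : ℝ} (ht : t ∈ Icc 0 T) (v : E3) : S.f t (S.ξ t) v = 0 := by
  obtain ⟨B, hB⟩ := S.exists_bound_df
  obtain ⟨BE, hBE⟩ := (integrable_coulomb (S.continuous_rho_slice t) (S.hasCompactSupport_rho t)).2
  have hB0 : 0 ≤ B := (norm_nonneg _).trans (hB 0)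
  have hgrad : ∀ v ω : E3, S.df (t, S.ξ t, v) (0, 0, ω) = 0 := by
    intro v ω
    rcases eq_or_ne ω 0 with rfl | hω
    · exact map_zero _
    have hω' : 0 < ‖ω‖ := norm_pos_iff.2 hω
    set K : ℝ := B * (1 + ‖v‖ + BE) with hK
    have hsmall : ∀ ε : ℝ, 0 < ε →
        ‖S.df (t, S.ξ t + ε • ω, v) (0, 0, ω)‖ ≤ ε ^ 2 * ‖ω‖ ^ 3 * K := by
      intro ε hε
      set x := S.ξ t + ε • ω with hx
      have hxξ : x - S.ξ t = ε • ω := by rw [hx]; abel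
      have hne : x ≠ S.ξ t := by
        rw [← sub_ne_zero, hxξ]
        exact smul_ne_zero hε.ne' hω
      have hF : Fpt S.ξ t x = (ε ^ 2 * ‖ω‖ ^ 3)⁻¹ • ω := by
        rw [Fpt, hxξ, norm_smul, Real.norm_of_nonneg hε.le, smul_smul]
        congr 1
        field_simp
      have hv := S.vlasov_df ht v hne
      have hsplit : S.df (t, x, v) (0, 0, ω) =
          -(ε ^ 2 * ‖ω‖ ^ 3) * S.df (t, x, v) (1, v, Efield S.f t x) := by
        have h1 : S.df (t, x, v) (1, v, Efield S.f t x) +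
            (ε ^ 2 * ‖ω‖ ^ 3)⁻¹ * S.df (t, x, v) (0, 0, ω) = 0 := by
          have e : ((1, v, Efield S.f t x) : ℝ × E3 × E3) +
              (ε ^ 2 * ‖ω‖ ^ 3)⁻¹ • ((0, 0, ω) : ℝ × E3 × E3) =
              (1, 0, 0) + (0, v, 0) + (0, 0, Efield S.f t x + Fpt S.ξ t x) := by
            simp only [Prod.smul_mk, Prod.mk_add_mk, smul_zero, add_zero, zero_add, hF]
          rw [← smul_eq_mul, ← map_smul, ← map_add, e, map_add, map_add]
          exact hv
        have h2 : ε ^ 2 * ‖ω‖ ^ 3 ≠ 0 := by positivity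
        field_simp at h1
        linarith
      rw [hsplit, norm_mul, norm_neg, Real.norm_of_nonneg (by positivity)]
      gcongr
      refine ((S.df (t, x, v)).le_opNorm _).trans ?_
      refine mul_le_mul (hB _) ?_ (norm_nonneg _) hB0
      have hE : ‖Efield S.f t x‖ ≤ BE := hBE x
      rw [Prod.norm_def, Prod.norm_def]
      have := norm_nonneg v
      have := (norm_nonneg _).trans hE
      simp only [norm_one]
      refine max_le (by linarith) (max_le (by linarith) (by linarith))
    have hlim : Tendsto (fun ε : ℝ => ‖S.df (t, S.ξ t + ε • ω, v) (0, 0, ω)‖)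
        (nhdsWithin 0 (Ioi 0)) (nhds ‖S.df (t, S.ξ t, v) (0, 0, ω)‖) := by
      have hc : Continuous (fun ε : ℝ => ‖S.df (t, S.ξ t + ε • ω, v) (0, 0, ω)‖) := by
        have := S.continuous_df
        fun_prop
      simpa using (hc.tendsto 0).mono_left nhdsWithin_le_nhds
    have hlim' : Tendsto (fun ε : ℝ => ε ^ 2 * ‖ω‖ ^ 3 * K) (nhdsWithin 0 (Ioi 0)) (nhds 0) := by
      have hc : Continuous (fun ε : ℝ => ε ^ 2 * ‖ω‖ ^ 3 * K) := by fun_prop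
      simpa using (hc.tendsto 0).mono_left nhdsWithin_le_nhds
    exact norm_le_zero_iff.1
      (le_of_tendsto_of_tendsto hlim hlim' (eventually_mem_nhdsWithin.mono hsmall))
  have hconst : ∀ w, S.f t (S.ξ t) v = S.f t (S.ξ t) w := fun w =>
    is_const_of_fderiv_eq_zero (𝕜 := ℝ)
      (fun w => (S.hasFDerivAt_velocity t (S.ξ t) w).differentiableAt)
      (fun w => by ext ω; rw [S.fderiv_velocity_apply, hgrad]; rfl) v w
  obtain ⟨R, hR⟩ := S.exists_support_radius
  obtain ⟨w, hw⟩ := NormedSpace.exists_lt_norm ℝ E3 R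
  rw [hconst w]
  exact (hR t _ w (hw.trans_le ((le_max_right _ _).trans (norm_snd_le t (S.ξ t, w))))).1

/-- The essential supremum of the initial datum is a pointwise bound. -/
theorem f_zero_le_supf0 (x v : E3) : S.f 0 x v ≤ supf0 S.f := by
  obtain ⟨B, hB⟩ := (S.hasCompactSupport_phase 0).exists_bound_of_continuous (S.continuous_phase 0)
  have hfin : eLpNorm (fun p : E3 × E3 => S.f 0 p.1 p.2) ⊤ volume ≠ ⊤ :=
    (memLp_top_of_bound (S.continuous_phase 0).aestronglyMeasurable B (ae_of_all _ hB)).2.ne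
  by_contra! hlt
  have hopen : IsOpen {p : E3 × E3 | supf0 S.f < S.f 0 p.1 p.2} :=
    isOpen_lt continuous_const (S.continuous_phase 0)
  have hpos := hopen.measure_pos volume ⟨(x, v), hlt⟩
  refine hpos.ne' (measure_mono_null (fun p hp => ?_)
    (ae_iff.1 (ae_le_eLpNormEssSup (f := fun p : E3 × E3 => S.f 0 p.1 p.2) (μ := volume))))
  intro hle
  rw [← eLpNorm_exponent_top] at hle
  have := ENNReal.toReal_mono hfin hle
  rw [toReal_enorm, Real.norm_of_nonneg (S.f_nonneg 0 p.1 p.2)] at this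
  exact absurd this (not_le.2 hp)

theorem supf0_nonneg : 0 ≤ supf0 S.f := ENNReal.toReal_nonneg

/-- The maximum principle: the density never exceeds the supremum of its initial datum. -/
theorem f_le_supf0 {τ : ℝ} (hτ : τ ∈ Icc 0 T) (x v : E3) : S.f τ x v ≤ supf0 S.f := by
  by_contra! hlt
  set M := supf0 S.f
  have hM0 : 0 ≤ M := S.supf0_nonneg
  set δ := (S.f τ x v - M) / (2 * (τ + 1)) with hδd
  have hτ1 : 0 < τ + 1 := by linarith [hτ.1]
  have hδ : 0 < δ := div_pos (sub_pos.2 hlt) (by positivity)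
  have hδτ : M < S.f τ x v - δ * τ := by
    have h1 : δ * (2 * (τ + 1)) = S.f τ x v - M := by rw [hδd]; field_simp
    nlinarith [hτ.1]
  obtain ⟨R, hR⟩ := S.exists_support_radius
  set Q : Set (ℝ × E3 × E3) := Icc 0 τ ×ˢ Metric.closedBall (0 : E3 × E3) (max R ‖(x, v)‖) with hQ
  have hQc : IsCompact Q := isCompact_Icc.prod (isCompact_closedBall _ _)
  have hmem : (τ, x, v) ∈ Q :=
    ⟨⟨hτ.1, le_rfl⟩, mem_closedBall_zero_iff.2 (le_max_right _ _)⟩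
  have hgc : Continuous (fun p : ℝ × E3 × E3 => S.f p.1 p.2.1 p.2.2 - δ * p.1) :=
    S.continuous_f.sub (by fun_prop)
  obtain ⟨⟨t', x', v'⟩, hpQ, hmax⟩ := hQc.exists_isMaxOn ⟨_, hmem⟩ hgc.continuousOn
  have hbig : M < S.f t' x' v' - δ * t' := hδτ.trans_le (hmax hmem)
  have ht'0 : 0 ≤ t' := hpQ.1.1
  have hf' : M < S.f t' x' v' := by nlinarith
  have ht'pos : 0 < t' := by
    rcases ht'0.eq_or_lt with h | h
    · rw [← h] at hf'
      exact absurd (S.f_zero_le_supf0 x' v') (not_le.2 hf')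
    · exact h
  have ht'T : t' ∈ Icc 0 T := ⟨ht'0, hpQ.1.2.trans hτ.2⟩
  have hx' : x' ≠ S.ξ t' := by
    rintro rfl
    rw [S.f_at_charge ht'T] at hf'
    linarith
  have hmax' : ∀ y w, S.f t' y w ≤ S.f t' x' v' := by
    intro y w
    by_cases hyw : (y, w) ∈ Metric.closedBall (0 : E3 × E3) (max R ‖(x, v)‖)
    · have hle : S.f t' y w - δ * t' ≤ S.f t' x' v' - δ * t' :=
        hmax (show (t', y, w) ∈ Q from ⟨hpQ.1, hyw⟩)
      linarith
    · rw [mem_closedBall_zero_iff, not_le] at hyw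
      rw [(hR t' y w (((le_max_left _ _).trans_lt hyw).trans_le (norm_snd_le t' (y, w)))).1]
      linarith
  have hgx : fderiv ℝ (fun y => S.f t' y v') x' = 0 :=
    IsLocalMax.fderiv_eq_zero (Eventually.of_forall fun y => hmax' y v')
  have hgv : fderiv ℝ (fun w => S.f t' x' w) v' = 0 :=
    IsLocalMax.fderiv_eq_zero (Eventually.of_forall fun w => hmax' x' w)
  have hdt : S.df (t', x', v') (1, 0, 0) = 0 := by
    have := S.vlasov_df ht'T v' hx'
    rw [← S.fderiv_space_apply, ← S.fderiv_velocity_apply, hgx, hgv] at this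
    simpa using this
  have hder : HasDerivAt (fun s => S.f s x' v' - δ * s) (-δ) t' := by
    have h := (S.hasDerivAt_time t' x' v').sub ((hasDerivAt_id t').const_mul δ)
    rw [hdt] at h
    simpa using! h
  have hslope := hder.hasDerivWithinAt (s := Iio t')
  rw [hasDerivWithinAt_iff_tendsto_slope' (by simp)] at hslope
  have : 0 ≤ -δ := by
    refine ge_of_tendsto hslope ?_
    filter_upwards [Ioo_mem_nhdsLT ht'pos] with s hs
    have hle : S.f s x' v' - δ * s ≤ S.f t' x' v' - δ * t' :=
      hmax (show (s, x', v') ∈ Q from ⟨⟨hs.1.le, hs.2.le.trans hpQ.1.2⟩, hpQ.2⟩)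
    rw [slope_def_field]
    exact div_nonneg_of_nonpos (by linarith) (by linarith [hs.2])
  linarith

/-- Conservation of mass. -/
theorem mass_eq {t : ℝ} (ht : t ∈ Icc 0 T) : mass S.f t = mass S.f 0 := by
  obtain ⟨R, hR⟩ := S.exists_support_radius
  obtain ⟨B, hB⟩ := S.exists_bound_df
  have hB0 : 0 ≤ B := (norm_nonneg _).trans (hB 0)
  have hcs : ∀ (t : ℝ) (G : E3 × E3 → ℝ × E3 × E3),
      HasCompactSupport (fun p : E3 × E3 => S.df (t, p) (G p)) := fun t G => by
    refine HasCompactSupport.intro (isCompact_closedBall 0 R) fun p hp => ?_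
    rw [mem_closedBall_zero_iff, not_le] at hp
    rw [(hR t p.1 p.2 (hp.trans_le (norm_snd_le t p))).2]
    rfl
  have hcont : ∀ (t : ℝ) (G : E3 × E3 → ℝ × E3 × E3), Continuous G →
      Continuous (fun p : E3 × E3 => S.df (t, p) (G p)) := fun t G hG => by
    have := S.continuous_df
    fun_prop
  have hder : ∀ t, HasDerivAt (fun t => mass S.f t)
      (∫ p : E3 × E3, S.df (t, p) (1, 0, 0)) t := fun t => by
    refine (hasDerivAt_integral_of_dominated_loc_of_deriv_le (s := univ)
      (F := fun t (p : E3 × E3) => S.f t p.1 p.2)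
      (F' := fun t (p : E3 × E3) => S.df (t, p) (1, 0, 0))
      (bound := (Metric.closedBall (0 : E3 × E3) R).indicator
        fun _ => B * ‖((1, 0, 0) : ℝ × E3 × E3)‖) univ_mem
      (Eventually.of_forall fun t => (S.continuous_phase t).aestronglyMeasurable)
      (S.integrable_phase t)
      (hcont t _ continuous_const).aestronglyMeasurable ?_ ?_ ?_).2
    · refine ae_of_all _ fun p t _ => ?_
      by_cases hp : p ∈ Metric.closedBall (0 : E3 × E3) R
      · rw [indicator_of_mem hp]
        exact ((S.df (t, p)).le_opNorm _).trans (by gcongr; exact hB _)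
      · rw [indicator_of_notMem hp]
        rw [mem_closedBall_zero_iff, not_le] at hp
        rw [(hR t p.1 p.2 (hp.trans_le (norm_snd_le t p))).2]
        simp
    · exact (integrableOn_const (isCompact_closedBall _ _).measure_lt_top.ne).integrable_indicator
        Metric.isClosed_closedBall.measurableSet
    · exact ae_of_all _ fun p t _ => S.hasDerivAt_time t p.1 p.2
  have hzero : ∀ t ∈ Icc 0 T, ∫ p : E3 × E3, S.df (t, p) (1, 0, 0) = 0 := by
    intro t ht
    have i1 : Integrable (fun p : E3 × E3 => S.df (t, p) (1, 0, 0)) :=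
      (hcont t _ continuous_const).integrable_of_hasCompactSupport (hcs t _)
    have i2 : Integrable (fun p : E3 × E3 => S.df (t, p) (0, p.2, 0)) :=
      (hcont t _ (by fun_prop)).integrable_of_hasCompactSupport (hcs t _)
    have hae : ∀ᵐ p : E3 × E3, S.df (t, p) (0, 0, Efield S.f t p.1 + Fpt S.ξ t p.1) =
        -(S.df (t, p) (1, 0, 0) + S.df (t, p) (0, p.2, 0)) := by
      have hnull : (volume : Measure (E3 × E3)) ({S.ξ t} ×ˢ univ) = 0 := by
        rw [Measure.volume_eq_prod, Measure.prod_prod]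
        simp
      filter_upwards [compl_mem_ae_iff.2 hnull] with p hp
      have hx : p.1 ≠ S.ξ t := fun h => hp ⟨h, mem_univ _⟩
      linarith [S.vlasov_df ht p.2 hx]
    have i3 : Integrable
        (fun p : E3 × E3 => S.df (t, p) (0, 0, Efield S.f t p.1 + Fpt S.ξ t p.1)) :=
      (i1.add i2).neg.congr (hae.mono fun p hp => by simp [hp])
    have z2 : ∫ p : E3 × E3, S.df (t, p) (0, p.2, 0) = 0 := by
      rw [Measure.volume_eq_prod, integral_prod_symm _ i2]
      refine integral_eq_zero_of_ae (ae_of_all _ fun v => ?_)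
      refine (integral_congr_ae (ae_of_all _ fun x => (S.fderiv_space_apply t x v v).symm)).trans
        (integral_fderiv_apply_eq_zero ?_ (S.hasCompactSupport_space t v) v)
      exact S.f_c1.comp (g := fun p : ℝ × E3 × E3 => S.f p.1 p.2.1 p.2.2)
        (f := fun x : E3 => (t, x, v)) (by fun_prop)
    have z3 : ∫ p : E3 × E3, S.df (t, p) (0, 0, Efield S.f t p.1 + Fpt S.ξ t p.1) = 0 := by
      rw [Measure.volume_eq_prod, integral_prod _ i3]
      refine integral_eq_zero_of_ae (ae_of_all _ fun x => ?_)
      refine (integral_congr_ae (ae_of_all _ fun v =>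
        (S.fderiv_velocity_apply t x v (Efield S.f t x + Fpt S.ξ t x)).symm)).trans
        (integral_fderiv_apply_eq_zero ?_ (S.hasCompactSupport_velocity t x) _)
      exact S.f_c1.comp (g := fun p : ℝ × E3 × E3 => S.f p.1 p.2.1 p.2.2)
        (f := fun v : E3 => (t, x, v)) (by fun_prop)
    rw [integral_congr_ae hae, integral_neg, integral_add i1 i2, z2] at z3
    linarith
  exact constant_of_has_deriv_right_zero (f := fun t => mass S.f t) (a := 0) (b := T)
    (fun t _ => (hder t).continuousAt.continuousWithinAt)
    (fun t ht => by
      have := (hder t).hasDerivWithinAt (s := Ici t)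
      rwa [hzero t (Ico_subset_Icc_self ht)] at this) t ht

end VPClassicalSolution

/-- The inverse-square field is Lipschitz outside a ball. -/
theorem norm_inverseSquare_sub_le {R : ℝ} (hR : 0 < R) {z w : E3} (hz : R ≤ ‖z‖) (hw : R ≤ ‖w‖) :
    ‖(‖z‖ ^ 3)⁻¹ • z - (‖w‖ ^ 3)⁻¹ • w‖ ≤ 4 / R ^ 3 * ‖z - w‖ := by
  set a := ‖z‖ with ha
  set b := ‖w‖ with hb
  have ha0 : 0 < a := hR.trans_le hz
  have hb0 : 0 < b := hR.trans_le hw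
  have hab : |b - a| ≤ ‖z - w‖ := by
    rw [abs_sub_comm]; exact abs_norm_sub_norm_le z w
  have e : (a ^ 3)⁻¹ • z - (b ^ 3)⁻¹ • w = (a ^ 3)⁻¹ • (z - w) + ((a ^ 3)⁻¹ - (b ^ 3)⁻¹) • w := by
    module
  have hinv : ∀ {x : ℝ}, R ^ 3 ≤ x → x⁻¹ ≤ (R ^ 3)⁻¹ := fun h => inv_anti₀ (by positivity) h
  have h3 : ((a ^ 3)⁻¹ - (b ^ 3)⁻¹) * b =
      (b - a) * ((a ^ 3)⁻¹ + (a ^ 2 * b)⁻¹ + (a * b ^ 2)⁻¹) := by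
    field_simp
    ring
  have h4 : (a ^ 3)⁻¹ + (a ^ 2 * b)⁻¹ + (a * b ^ 2)⁻¹ ≤ 3 * (R ^ 3)⁻¹ := by
    have h5 := hinv (show R ^ 3 ≤ a ^ 3 by gcongr)
    have h6 := hinv (show R ^ 3 ≤ a ^ 2 * b by
      calc R ^ 3 = R ^ 2 * R := by ring
        _ ≤ _ := by gcongr)
    have h7 := hinv (show R ^ 3 ≤ a * b ^ 2 by
      calc R ^ 3 = R * R ^ 2 := by ring
        _ ≤ _ := by gcongr)
    linarith
  rw [e]
  refine (norm_add_le _ _).trans ?_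
  have h8 : ‖(a ^ 3)⁻¹ • (z - w)‖ ≤ (R ^ 3)⁻¹ * ‖z - w‖ := by
    rw [norm_smul, Real.norm_of_nonneg (by positivity)]
    gcongr
  have h9 : ‖((a ^ 3)⁻¹ - (b ^ 3)⁻¹) • w‖ ≤ ‖z - w‖ * (3 * (R ^ 3)⁻¹) := by
    rw [norm_smul, ← hb, Real.norm_eq_abs, ← abs_of_pos hb0, ← abs_mul, abs_of_pos hb0, h3, abs_mul,
      abs_of_nonneg (show 0 ≤ (a ^ 3)⁻¹ + (a ^ 2 * b)⁻¹ + (a * b ^ 2)⁻¹ by positivity)]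
    gcongr
  calc _ ≤ (R ^ 3)⁻¹ * ‖z - w‖ + ‖z - w‖ * (3 * (R ^ 3)⁻¹) := add_le_add h8 h9
    _ = 4 / R ^ 3 * ‖z - w‖ := by ring

/-- Kernel of the external fields, `(1 - χ_R(z)) z/|z|³`. -/
def extKernel (T : ℝ) (f : ℝ → E3 → E3 → ℝ) (c : CutoffData) (z : E3) : E3 :=
  (1 - chiR T f c z) • (‖z‖ ^ 3)⁻¹ • z

namespace VPClassicalSolution

variable {T : ℝ} (S : VPClassicalSolution T) (c : CutoffData)

theorem Rcut_base_pos : 0 < 24 * c.K0 * (1 + mass S.f 0) := by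
  have := S.mass_nonneg 0
  have := c.K0_ge
  positivity

theorem Rcut_pos : 0 < Rcut T S.f c.K0 := by
  have := S.T_pos
  exact mul_pos (Real.rpow_pos_of_pos (S.Rcut_base_pos c) _) (by linarith)

theorem Rcut_pow_three :
    Rcut T S.f c.K0 ^ 3 = 24 * c.K0 * (1 + mass S.f 0) * (1 + T) ^ 3 := by
  rw [Rcut, mul_pow, ← Real.rpow_natCast, ← Real.rpow_mul (S.Rcut_base_pos c).le]
  norm_num

theorem continuous_chiR : Continuous (chiR T S.f c) :=
  c.smooth.continuous.comp (continuous_const_smul _)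

theorem abs_chiR_sub_le (z w : E3) :
    |chiR T S.f c z - chiR T S.f c w| ≤ 2 / Rcut T S.f c.K0 * ‖z - w‖ := by
  have hR := S.Rcut_pos c
  have h := (convex_univ (𝕜 := ℝ) (E := E3)).norm_image_sub_le_of_norm_fderiv_le (𝕜 := ℝ)
    (f := c.χ) (C := 2) (x := (Rcut T S.f c.K0)⁻¹ • w) (y := (Rcut T S.f c.K0)⁻¹ • z)
    (fun x _ => c.smooth.differentiable (by simp) x) (fun x _ => c.grad_le x)
    (mem_univ _) (mem_univ _)
  rw [← smul_sub, norm_smul, norm_inv, Real.norm_of_nonneg hR.le] at h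
  refine h.trans_eq ?_
  ring

theorem chiR_eq_one {z : E3} (hz : ‖z‖ ≤ Rcut T S.f c.K0) : chiR T S.f c z = 1 := by
  have hR := S.Rcut_pos c
  refine c.eq_one _ ?_
  rw [norm_smul, norm_inv, Real.norm_of_nonneg hR.le, inv_mul_le_iff₀ hR]
  simpa using hz

theorem norm_extKernel_sub_le_of_le {z w : E3} (hz : ‖z‖ ≤ Rcut T S.f c.K0)
    (hw : Rcut T S.f c.K0 ≤ ‖w‖) :
    ‖extKernel T S.f c z - extKernel T S.f c w‖ ≤ 6 / Rcut T S.f c.K0 ^ 3 * ‖z - w‖ := by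
  have hR := S.Rcut_pos c
  have hχ := S.abs_chiR_sub_le c z w
  have hw0 : 0 < ‖w‖ := hR.trans_le hw
  set R := Rcut T S.f c.K0
  rw [S.chiR_eq_one c hz] at hχ
  rw [extKernel, S.chiR_eq_one c hz, extKernel, sub_self, zero_smul, zero_sub, norm_neg, norm_smul,
    norm_smul, norm_inv, norm_pow, norm_norm, Real.norm_eq_abs]
  have h1 : (‖w‖ ^ 3)⁻¹ * ‖w‖ ≤ (R ^ 2)⁻¹ := by
    have : (‖w‖ ^ 3)⁻¹ * ‖w‖ = (‖w‖ ^ 2)⁻¹ := by field_simp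
    rw [this]
    gcongr
  calc _ ≤ (2 / R * ‖z - w‖) * (R ^ 2)⁻¹ := by gcongr
    _ = 2 / R ^ 3 * ‖z - w‖ := by field_simp
    _ ≤ _ := by gcongr; norm_num

theorem norm_extKernel_sub_le (z w : E3) :
    ‖extKernel T S.f c z - extKernel T S.f c w‖ ≤ 6 / Rcut T S.f c.K0 ^ 3 * ‖z - w‖ := by
  have hR := S.Rcut_pos c
  rcases le_total ‖z‖ (Rcut T S.f c.K0) with hz | hz <;>
    rcases le_total ‖w‖ (Rcut T S.f c.K0) with hw | hw
  · simp only [extKernel, S.chiR_eq_one c hz, S.chiR_eq_one c hw, sub_self, zero_smul, norm_zero]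
    positivity
  · exact S.norm_extKernel_sub_le_of_le c hz hw
  · rw [norm_sub_rev, norm_sub_rev z]
    exact S.norm_extKernel_sub_le_of_le c hw hz
  · have hχ := S.abs_chiR_sub_le c z w
    have hz0 : 0 < ‖z‖ := hR.trans_le hz
    have h01 : chiR T S.f c w ∈ Icc (0 : ℝ) 1 := c.mem_Icc _
    set R := Rcut T S.f c.K0
    have hk := norm_inverseSquare_sub_le hR hz hw
    have h1 : ‖(‖z‖ ^ 3)⁻¹ • z‖ ≤ (R ^ 2)⁻¹ := by
      rw [norm_smul, norm_inv, norm_pow, norm_norm]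
      have : (‖z‖ ^ 3)⁻¹ * ‖z‖ = (‖z‖ ^ 2)⁻¹ := by field_simp
      rw [this]
      gcongr
    have e : extKernel T S.f c z - extKernel T S.f c w =
        (1 - chiR T S.f c w) • ((‖z‖ ^ 3)⁻¹ • z - (‖w‖ ^ 3)⁻¹ • w)
          - (chiR T S.f c z - chiR T S.f c w) • ((‖z‖ ^ 3)⁻¹ • z) := by
      simp only [extKernel]; module
    rw [e]
    refine (norm_sub_le _ _).trans ?_
    have h2 : ‖(1 - chiR T S.f c w) • ((‖z‖ ^ 3)⁻¹ • z - (‖w‖ ^ 3)⁻¹ • w)‖ ≤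
        4 / R ^ 3 * ‖z - w‖ := by
      rw [norm_smul, Real.norm_of_nonneg (by linarith [h01.2])]
      exact (mul_le_of_le_one_left (norm_nonneg _) (by linarith [h01.1])).trans hk
    have h3 : ‖(chiR T S.f c z - chiR T S.f c w) • ((‖z‖ ^ 3)⁻¹ • z)‖ ≤
        (2 / R * ‖z - w‖) * (R ^ 2)⁻¹ := by
      rw [norm_smul, Real.norm_eq_abs]
      gcongr
    calc _ ≤ 4 / R ^ 3 * ‖z - w‖ + (2 / R * ‖z - w‖) * (R ^ 2)⁻¹ := add_le_add h2 h3
      _ = 6 / R ^ 3 * ‖z - w‖ := by field_simp; ring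

theorem continuous_extKernel : Continuous (extKernel T S.f c) := by
  have hR := S.Rcut_pos c
  refine (LipschitzWith.of_dist_le_mul (K := ⟨6 / Rcut T S.f c.K0 ^ 3, by positivity⟩)
    fun z w => ?_).continuous
  rw [dist_eq_norm, dist_eq_norm]
  exact S.norm_extKernel_sub_le c z w

theorem integrable_rho_smul_extKernel (t : ℝ) (x : E3) :
    Integrable (fun y => rho S.f t y • extKernel T S.f c (x - y)) := by
  have h1 := S.continuous_rho_slice t
  have h2 := S.continuous_extKernel c
  exact Continuous.integrable_of_hasCompactSupport (by fun_prop)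
    ((S.hasCompactSupport_rho t).smul_right)

theorem Eext_eq (t : ℝ) (x : E3) :
    Eext T S.f c t x = ∫ y, rho S.f t y • extKernel T S.f c (x - y) := by
  have h1 := S.continuous_rho_slice t
  have h2 := S.continuous_chiR c
  have i1 := (integrable_coulomb h1 (S.hasCompactSupport_rho t)).1 x
  have i2 := (integrable_coulomb (ρ := fun y => chiR T S.f c (x - y) * rho S.f t y)
    (by fun_prop) ((S.hasCompactSupport_rho t).mul_left)).1 x
  rw [Eext, Efield, Eint, ← integral_sub i1 i2]
  refine integral_congr_ae (ae_of_all _ fun y => ?_)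
  simp only [extKernel]
  module

theorem Fext_eq (t : ℝ) (x : E3) :
    Fext T S.f S.ξ c t x = extKernel T S.f c (x - S.ξ t) := by
  simp only [Fext, Fint, Fpt, extKernel]
  module

theorem continuous_external_field :
    Continuous (fun p : ℝ × E3 => Eext T S.f c p.1 p.2 + Fext T S.f S.ξ c p.1 p.2) := by
  have hk := S.continuous_extKernel c
  have hξ := S.ξ_c2.continuous
  have hρ := S.continuous_rho
  simp only [S.Fext_eq]
  refine Continuous.add ?_ (by fun_prop)
  obtain ⟨R, hR⟩ := S.exists_rho_support
  have e : (fun p : ℝ × E3 => Eext T S.f c p.1 p.2) = fun p : ℝ × E3 =>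
      ∫ y in Metric.closedBall (0 : E3) R, rho S.f p.1 y • extKernel T S.f c (p.2 - y) := by
    funext p
    rw [S.Eext_eq]
    refine (setIntegral_eq_integral_of_forall_compl_eq_zero fun y hy => ?_).symm
    rw [mem_closedBall_zero_iff, not_le] at hy
    rw [hR p.1 y hy, zero_smul]
  rw [e]
  refine continuous_parametric_integral_of_continuous
    (f := fun (p : ℝ × E3) y => rho S.f p.1 y • extKernel T S.f c (p.2 - y)) ?_
    (isCompact_closedBall 0 R)
  have h1 : Continuous (fun q : (ℝ × E3) × E3 => rho S.f q.1.1 q.2) :=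
    hρ.comp (g := fun p : ℝ × E3 => rho S.f p.1 p.2)
      (f := fun q : (ℝ × E3) × E3 => (q.1.1, q.2)) (by fun_prop)
  exact h1.smul (by fun_prop)

theorem norm_external_field_sub_le {t : ℝ} (ht : t ∈ Icc 0 T) (x y : E3) :
    ‖(Eext T S.f c t x + Fext T S.f S.ξ c t x) - (Eext T S.f c t y + Fext T S.f S.ξ c t y)‖ ≤
      1 / (400 * (1 + T) ^ 3) * ‖x - y‖ := by
  have hR := S.Rcut_pos c
  have hR3 := S.Rcut_pow_three c
  have hm := S.mass_nonneg 0
  have hK := c.K0_ge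
  have hT := S.T_pos
  have hker := S.norm_extKernel_sub_le c
  set R := Rcut T S.f c.K0
  have hE : ‖Eext T S.f c t x - Eext T S.f c t y‖ ≤ mass S.f 0 * (6 / R ^ 3 * ‖x - y‖) := by
    rw [S.Eext_eq, S.Eext_eq, ← integral_sub (S.integrable_rho_smul_extKernel c t x)
      (S.integrable_rho_smul_extKernel c t y)]
    refine (norm_integral_le_of_norm_le (g := fun z => rho S.f t z * (6 / R ^ 3 * ‖x - y‖))
      (((S.continuous_rho_slice t).integrable_of_hasCompactSupport
        (S.hasCompactSupport_rho t)).mul_const _) (ae_of_all _ fun z => ?_)).trans_eq ?_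
    · rw [← smul_sub, norm_smul, Real.norm_of_nonneg (S.rho_nonneg t z)]
      refine mul_le_mul_of_nonneg_left ((hker _ _).trans_eq ?_) (S.rho_nonneg t z)
      rw [sub_sub_sub_cancel_right]
    · rw [integral_mul_const, S.integral_rho, S.mass_eq ht]
  have hF : ‖Fext T S.f S.ξ c t x - Fext T S.f S.ξ c t y‖ ≤ 6 / R ^ 3 * ‖x - y‖ := by
    rw [S.Fext_eq, S.Fext_eq]
    refine (hker _ _).trans_eq ?_
    rw [sub_sub_sub_cancel_right]
  rw [add_sub_add_comm]
  refine (norm_add_le _ _).trans ((add_le_add hE hF).trans ?_)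
  have e : mass S.f 0 * (6 / R ^ 3 * ‖x - y‖) + 6 / R ^ 3 * ‖x - y‖ =
      1 / (4 * c.K0 * (1 + T) ^ 3) * ‖x - y‖ := by
    rw [hR3]
    have : 0 < c.K0 := by linarith
    field_simp
    ring
  rw [e]
  have h400 : 400 * (1 + T) ^ 3 ≤ 4 * c.K0 * (1 + T) ^ 3 := by
    gcongr
    linarith
  gcongr

end VPClassicalSolution

/-- For a weak force over a short time, the velocity difference of two trajectories starting at
the same point stays comparable to its initial value. -/
theorem norm_velocity_le_two_mul {D W W' : ℝ → E3} {L s : ℝ} (hL : 0 ≤ L) (hs : 0 ≤ s)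
    (hLs : L * s ^ 2 ≤ 1 / 4) (hD0 : D 0 = 0) (hD : ∀ u ∈ Icc 0 s, HasDerivAt D (-W u) u)
    (hW : ∀ u ∈ Icc 0 s, HasDerivAt W (W' u) u) (hW' : ∀ u ∈ Icc 0 s, ‖W' u‖ ≤ L * ‖D u‖) :
    ‖W 0‖ ≤ 2 * ‖W s‖ := by
  have cD : ContinuousOn D (Icc 0 s) := fun u hu => (hD u hu).continuousAt.continuousWithinAt
  obtain ⟨u₀, hu₀, hmax⟩ := isCompact_Icc.exists_isMaxOn (nonempty_Icc.2 hs) cD.norm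
  set A := ‖D u₀‖ with hA
  have hA0 : 0 ≤ A := norm_nonneg _
  have hDA : ∀ u ∈ Icc 0 s, ‖D u‖ ≤ A := fun u hu => hmax hu
  have hWu : ∀ u ∈ Icc 0 s, ‖W u - W 0‖ ≤ L * A * s := fun u hu => by
    have h := norm_sub_sub_smul_le (ε := L * A) (w := 0) hu.1
      (fun r hr => hW r ⟨hr.1, hr.2.trans hu.2⟩) (fun r hr => by
        have hr' : r ∈ Icc 0 s := ⟨hr.1, hr.2.trans hu.2⟩
        rw [sub_zero]
        exact (hW' r hr').trans (mul_le_mul_of_nonneg_left (hDA r hr') hL))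
    rw [smul_zero, sub_zero, sub_zero] at h
    exact h.trans (mul_le_mul_of_nonneg_left hu.2 (by positivity))
  have hDu : ‖D u₀ - u₀ • (-W 0)‖ ≤ L * A * s * s := by
    have h := norm_sub_sub_smul_le (ε := L * A * s) (w := -W 0) hu₀.1
      (fun r hr => hD r ⟨hr.1, hr.2.trans hu₀.2⟩) (fun r hr => by
        rw [show -W r - -W 0 = -(W r - W 0) by abel, norm_neg]
        exact hWu r ⟨hr.1, hr.2.trans hu₀.2⟩)
    rw [hD0, sub_zero, sub_zero] at h
    exact h.trans (mul_le_mul_of_nonneg_left hu₀.2 (by positivity))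
  have hAle : A ≤ L * A * s * s + s * ‖W 0‖ := by
    have h1 := norm_le_norm_sub_add (D u₀) (u₀ • (-W 0))
    rw [norm_smul, norm_neg, Real.norm_of_nonneg hu₀.1] at h1
    have h2 : u₀ * ‖W 0‖ ≤ s * ‖W 0‖ := mul_le_mul_of_nonneg_right hu₀.2 (norm_nonneg _)
    linarith
  have hA2 : A ≤ 4 / 3 * (s * ‖W 0‖) := by nlinarith
  have h3 : L * A * s ≤ 1 / 3 * ‖W 0‖ := by
    have : L * A * s ≤ L * (4 / 3 * (s * ‖W 0‖)) * s := by gcongr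
    nlinarith [norm_nonneg (W 0)]
  have h4 := norm_le_norm_sub_add (W 0) (W s)
  rw [norm_sub_rev] at h4
  have h5 := hWu s (right_mem_Icc.2 hs)
  linarith [norm_nonneg (W s)]

theorem rpow_le_of_forall_le_add {r c M m b : ℝ} (hr : 0 ≤ r) (hc : 0 ≤ c) (hM : 0 < M)
    (hm : 0 < m) (hb : 0 < b) (h : ∀ P : ℝ, 0 < P → r ≤ c * M * P ^ 3 + P ^ (-b) * m) :
    r ^ ((b + 3) / 3) ≤ (c + 1) ^ ((b + 3) / 3) * M ^ (b / 3) * m := by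
  have hP : 0 < (m / M) ^ (1 / (3 + b)) := by positivity
  have hmM : 0 ≤ m / M := by positivity
  set Q := M ^ (b / (3 + b)) * m ^ (3 / (3 + b)) with hQ
  have e1 : M * ((m / M) ^ (1 / (3 + b))) ^ 3 = Q := by
    rw [← Real.rpow_natCast, ← Real.rpow_mul hmM, Real.div_rpow hm.le hM.le, hQ,
      show b / (3 + b) = 1 - 3 / (3 + b) by field_simp; ring, Real.rpow_sub hM, Real.rpow_one,
      show 1 / (3 + b) * ((3 : ℕ) : ℝ) = 3 / (3 + b) by push_cast; ring]
    ring
  have e2 : ((m / M) ^ (1 / (3 + b))) ^ (-b) * m = Q := by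
    rw [← Real.rpow_mul hmM, Real.div_rpow hm.le hM.le, hQ,
      show 1 / (3 + b) * -b = -(b / (3 + b)) by ring, Real.rpow_neg hm.le, Real.rpow_neg hM.le,
      show 3 / (3 + b) = 1 - b / (3 + b) by field_simp; ring, Real.rpow_sub hm, Real.rpow_one]
    field_simp
  have hrQ : r ≤ (c + 1) * Q := by
    have := h _ hP
    rw [mul_assoc, e1, e2] at this
    linarith
  calc r ^ ((b + 3) / 3) ≤ ((c + 1) * Q) ^ ((b + 3) / 3) := by gcongr
    _ = (c + 1) ^ ((b + 3) / 3) * M ^ (b / 3) * m := by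
      rw [Real.mul_rpow (by positivity) (by positivity), hQ,
        Real.mul_rpow (by positivity) (by positivity), ← Real.rpow_mul hM.le,
        ← Real.rpow_mul hm.le,
        show b / (3 + b) * ((b + 3) / 3) = b / 3 by field_simp; ring,
        show 3 / (3 + b) * ((b + 3) / 3) = 1 by field_simp; ring, Real.rpow_one]
      ring

/-- The constant of the interpolation estimate: the volume of a ball of radius four. -/
def interpConst : ℝ := 4 ^ 3 * (volume (Metric.ball (0 : E3) 1)).toReal

theorem interpConst_nonneg : 0 ≤ interpConst := by
  unfold interpConst; positivity

theorem volume_setOf_norm_le {W : E3 → E3} (hW : ∀ v v', ‖v - v'‖ ≤ 2 * ‖W v - W v'‖) {P : ℝ}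
    (hP : 0 ≤ P) : volume {v | ‖W v‖ ≤ P} ≤ ENNReal.ofReal (interpConst * P ^ 3) := by
  rcases eq_empty_or_nonempty {v | ‖W v‖ ≤ P} with h | ⟨v₀, hv₀⟩
  · rw [h, measure_empty]; exact zero_le
  have hsub : {v | ‖W v‖ ≤ P} ⊆ Metric.closedBall v₀ (4 * P) := fun v hv => by
    rw [Metric.mem_closedBall, dist_eq_norm]
    have h1 : ‖W v‖ ≤ P := hv
    have h2 : ‖W v₀‖ ≤ P := hv₀
    linarith [hW v v₀, norm_sub_le (W v) (W v₀)]
  refine (measure_mono hsub).trans_eq ?_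
  rw [Measure.addHaar_closedBall _ _ (by positivity), finrank_euclideanSpace_fin,
    ← ENNReal.ofReal_toReal (measure_ball_lt_top (μ := volume) (x := (0 : E3)) (r := 1)).ne,
    ← ENNReal.ofReal_mul (by positivity), interpConst]
  congr 1
  ring

/-- Velocity interpolation at a fixed position. -/
theorem lintegral_rpow_le_moment {g : E3 → ℝ} {W : E3 → E3} {M b : ℝ} (hg : ∀ v, 0 ≤ g v)
    (hgM : ∀ v, g v ≤ M) (hM : 0 < M) (hb : 0 < b) (hWm : Measurable W)
    (hW : ∀ v v', ‖v - v'‖ ≤ 2 * ‖W v - W v'‖) :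
    (∫⁻ v, ENNReal.ofReal (g v)) ^ ((b + 3) / 3) ≤
      ENNReal.ofReal ((interpConst + 1) ^ ((b + 3) / 3) * M ^ (b / 3)) *
        ∫⁻ v, ENNReal.ofReal (‖W v‖ ^ b * g v) := by
  have hc := interpConst_nonneg
  set K := (interpConst + 1) ^ ((b + 3) / 3) * M ^ (b / 3) with hK
  have hK0 : 0 < K := by positivity
  set r := ∫⁻ v, ENNReal.ofReal (g v) with hr
  set m := ∫⁻ v, ENNReal.ofReal (‖W v‖ ^ b * g v) with hm
  rcases eq_or_ne m ⊤ with htop | htop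
  · rw [htop, ENNReal.mul_top (by simpa using hK0)]
    exact le_top
  have split : ∀ P : ℝ, 0 < P →
      r ≤ ENNReal.ofReal (interpConst * M * P ^ 3) + ENNReal.ofReal (P ^ (-b)) * m := by
    intro P hP
    have hSm : MeasurableSet {v | ‖W v‖ ≤ P} := measurableSet_le hWm.norm measurable_const
    rw [hr, ← lintegral_add_compl _ hSm]
    refine add_le_add ?_ ?_
    · calc _ ≤ ∫⁻ _ in {v | ‖W v‖ ≤ P}, ENNReal.ofReal M :=
            lintegral_mono fun v => ENNReal.ofReal_le_ofReal (hgM v)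
        _ = ENNReal.ofReal M * volume {v | ‖W v‖ ≤ P} := setLIntegral_const _ _
        _ ≤ ENNReal.ofReal M * ENNReal.ofReal (interpConst * P ^ 3) := by
            gcongr
            exact volume_setOf_norm_le hW hP.le
        _ = _ := by
            rw [← ENNReal.ofReal_mul hM.le]
            congr 1
            ring
    · rw [hm, ← lintegral_const_mul' _ _ ENNReal.ofReal_ne_top]
      refine (setLIntegral_mono_ae' hSm.compl (ae_of_all _ fun v hv => ?_)).trans
        (setLIntegral_le_lintegral _ _)
      have hv' : P < ‖W v‖ := not_le.1 hv
      rw [← ENNReal.ofReal_mul (by positivity)]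
      refine ENNReal.ofReal_le_ofReal ?_
      rw [← mul_assoc]
      refine le_mul_of_one_le_left (hg v) ?_
      rw [Real.rpow_neg hP.le, ← div_eq_inv_mul, one_le_div (by positivity)]
      gcongr
  have hrtop : r ≠ ⊤ := ((split 1 one_pos).trans_lt (ENNReal.add_lt_top.2
    ⟨ENNReal.ofReal_lt_top, ENNReal.mul_lt_top ENNReal.ofReal_lt_top htop.lt_top⟩)).ne
  have hreal : ∀ P : ℝ, 0 < P → r.toReal ≤ interpConst * M * P ^ 3 + P ^ (-b) * m.toReal := by
    intro P hP
    have hP' : 0 ≤ P ^ (-b) := by positivity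
    have hP3 : 0 ≤ interpConst * M * P ^ 3 := by positivity
    have := split P hP
    rw [← ENNReal.ofReal_toReal htop, ← ENNReal.ofReal_mul hP', ← ENNReal.ofReal_add hP3
      (by positivity)] at this
    exact ENNReal.toReal_le_of_le_ofReal (by positivity) this
  have hfin : r.toReal ^ ((b + 3) / 3) ≤ K * m.toReal := by
    refine le_of_forall_pos_le_add fun ε hε => ?_
    have := rpow_le_of_forall_le_add (m := m.toReal + ε / K) ENNReal.toReal_nonneg hc hM
      (by positivity) hb (fun P hP => (hreal P hP).trans (by gcongr; linarith [div_pos hε hK0]))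
    refine this.trans_eq ?_
    rw [← hK]
    field_simp
  rw [← ENNReal.ofReal_toReal hrtop, ENNReal.ofReal_rpow_of_nonneg ENNReal.toReal_nonneg
    (by positivity), ← ENNReal.ofReal_toReal htop, ← ENNReal.ofReal_mul hK0.le]
  exact ENNReal.ofReal_le_ofReal hfin

namespace BackwardFlow

variable {T : ℝ} {S : VPClassicalSolution T} {c : CutoffData} {t : ℝ} (Φ : BackwardFlow T S c t)

theorem lipschitz_field (ht : t ∈ Icc 0 T) {s : ℝ} (hs : s ∈ Icc 0 t) :
    ∀ u ∈ Icc 0 s, ∀ x y,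
      ‖(Eext T S.f c (t - u) x + Fext T S.f S.ξ c (t - u) x) -
        (Eext T S.f c (t - u) y + Fext T S.f S.ξ c (t - u) y)‖ ≤
      1 / (400 * (1 + T) ^ 3) * ‖x - y‖ := fun u hu x y =>
  S.norm_external_field_sub_le c
    ⟨by linarith [hu.2, hs.2], by linarith [hu.1, ht.2]⟩ x y

theorem norm_sub_le_two_mul (ht : t ∈ Icc 0 T) {s : ℝ} (hs : s ∈ Icc 0 t) (x v v' : E3) :
    ‖v - v'‖ ≤ 2 * ‖Φ.V s x v - Φ.V s x v'‖ := by
  have hT := S.T_pos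
  have hsub : Icc 0 s ⊆ Icc 0 t := Icc_subset_Icc_right hs.2
  have hsmall : 1 / (400 * (1 + T) ^ 3) * s ^ 2 ≤ 1 / 4 := by
    have h1 : s ^ 2 ≤ (1 + T) ^ 2 := by
      have := hs.1
      gcongr
      linarith [hs.2, ht.2]
    have h2 : (1 + T) ^ 2 ≤ (1 + T) ^ 3 := pow_le_pow_right₀ (by linarith) (by norm_num)
    rw [div_mul_eq_mul_div, div_le_iff₀ (by positivity)]
    nlinarith
  have key := norm_velocity_le_two_mul (L := 1 / (400 * (1 + T) ^ 3)) (s := s)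
    (D := fun u => Φ.X u x v - Φ.X u x v') (W := fun u => Φ.V u x v - Φ.V u x v')
    (by positivity) hs.1 hsmall (by simp [Φ.init_X])
    (fun u hu => by
      have h := (Φ.ode_X x v u (hsub hu)).sub (Φ.ode_X x v' u (hsub hu))
      rwa [neg_sub_neg, ← neg_sub (Φ.V u x v)] at h)
    (fun u hu => (Φ.ode_V x v u (hsub hu)).sub (Φ.ode_V x v' u (hsub hu)))
    (fun u hu => by
      rw [neg_sub_neg, norm_sub_rev]
      exact lipschitz_field ht hs u hu _ _)
  simpa only [Φ.init_V] using key

theorem measurable_and_lintegral_le (ht : t ∈ Icc 0 T) {s : ℝ} (hs : s ∈ Icc 0 t) :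
    Measurable (fun p : E3 × E3 => (Φ.X s p.1 p.2, Φ.V s p.1 p.2)) ∧
      ∀ g : E3 × E3 → ℝ≥0∞, Continuous g →
        ∫⁻ p : E3 × E3, g (Φ.X s p.1 p.2, Φ.V s p.1 p.2) ≤ ∫⁻ p : E3 × E3, g p := by
  have hT := S.T_pos
  have hsub : Icc 0 s ⊆ Icc 0 t := Icc_subset_Icc_right hs.2
  refine lintegral_comp_flow_le (L := 1 / (400 * (1 + T) ^ 3))
    (G := fun u x => Eext T S.f c (t - u) x + Fext T S.f S.ξ c (t - u) x)
    (by positivity) hs.1 ?_ (lipschitz_field ht hs) Φ.init_X Φ.init_V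
    (fun x v u hu => Φ.ode_X x v u (hsub hu)) (fun x v u hu => Φ.ode_V x v u (hsub hu))
  exact (S.continuous_external_field c).comp (f := fun p : ℝ × E3 => (t - p.1, p.2)) (by fun_prop)

/-- The sharp form of the interpolation estimate along the backward flow. -/
theorem eLpNorm_density_le (ht : t ∈ Icc 0 T) {τ s b : ℝ} (hτ : τ ∈ Icc 0 t) (hs : s ∈ Icc 0 t)
    (hb : 0 < b) :
    eLpNorm (fun x : E3 => ∫ v : E3, S.f τ (Φ.X s x v) (Φ.V s x v))
        (ENNReal.ofReal ((b + 3) / 3)) volume ≤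
      ENNReal.ofReal ((interpConst + 1) * supf0 S.f ^ (b / (3 + b))
        * (∫ p : E3 × E3, ‖p.2‖ ^ b * S.f τ p.1 p.2) ^ (3 / (3 + b))) := by
  have hτT : τ ∈ Icc 0 T := ⟨hτ.1, hτ.2.trans ht.2⟩
  have hle : ∀ x v, S.f τ x v ≤ supf0 S.f := S.f_le_supf0 hτT
  rcases S.supf0_nonneg.eq_or_lt with h0 | hM
  · have hz : ∀ x v, S.f τ x v = 0 := fun x v =>
      le_antisymm (by rw [h0]; exact hle x v) (S.f_nonneg τ x v)
    simp [hz]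
  have hc := interpConst_nonneg
  obtain ⟨hmeas, hlint⟩ := Φ.measurable_and_lintegral_le ht hs
  set M := supf0 S.f
  set p := (b + 3) / 3 with hp
  have hp0 : 0 < p := by positivity
  set K := (interpConst + 1) ^ p * M ^ (b / 3) with hK
  have hK0 : 0 < K := by positivity
  set J := ∫ p : E3 × E3, ‖p.2‖ ^ b * S.f τ p.1 p.2 with hJ
  have hJ0 : 0 ≤ J := integral_nonneg fun p =>
    mul_nonneg (Real.rpow_nonneg (norm_nonneg _) _) (S.f_nonneg _ _ _)
  have hgc : Continuous (fun p : E3 × E3 => ‖p.2‖ ^ b * S.f τ p.1 p.2) :=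
    (continuous_snd.norm.rpow_const fun _ => Or.inr hb.le).mul (S.continuous_phase τ)
  have hgi : Integrable (fun p : E3 × E3 => ‖p.2‖ ^ b * S.f τ p.1 p.2) :=
    hgc.integrable_of_hasCompactSupport (S.hasCompactSupport_phase τ).mul_left
  have hpt : ∀ x, ‖∫ v : E3, S.f τ (Φ.X s x v) (Φ.V s x v)‖ₑ ^ p ≤
      ENNReal.ofReal K *
        ∫⁻ v, ENNReal.ofReal (‖Φ.V s x v‖ ^ b * S.f τ (Φ.X s x v) (Φ.V s x v)) := fun x => by
    refine (ENNReal.rpow_le_rpow (enorm_integral_le_lintegral_enorm _) hp0.le).trans ?_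
    have e : ∀ v, ‖S.f τ (Φ.X s x v) (Φ.V s x v)‖ₑ =
        ENNReal.ofReal (S.f τ (Φ.X s x v) (Φ.V s x v)) := fun v =>
      Real.enorm_of_nonneg (S.f_nonneg _ _ _)
    simp only [e]
    exact lintegral_rpow_le_moment (fun v => S.f_nonneg _ _ _) (fun v => hle _ _) hM hb
      (hmeas.snd.comp measurable_prodMk_left) (Φ.norm_sub_le_two_mul ht hs x)
  have hmain : ∫⁻ x, ‖∫ v : E3, S.f τ (Φ.X s x v) (Φ.V s x v)‖ₑ ^ p ≤ ENNReal.ofReal (K * J) := by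
    calc _ ≤ ∫⁻ x, ENNReal.ofReal K *
          ∫⁻ v, ENNReal.ofReal (‖Φ.V s x v‖ ^ b * S.f τ (Φ.X s x v) (Φ.V s x v)) :=
          lintegral_mono hpt
      _ = ENNReal.ofReal K * ∫⁻ q : E3 × E3,
          ENNReal.ofReal (‖Φ.V s q.1 q.2‖ ^ b * S.f τ (Φ.X s q.1 q.2) (Φ.V s q.1 q.2)) := by
          rw [lintegral_const_mul' _ _ ENNReal.ofReal_ne_top, Measure.volume_eq_prod,
            lintegral_prod]
          exact (hgc.measurable.comp hmeas).ennreal_ofReal.aemeasurable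
      _ ≤ ENNReal.ofReal K * ∫⁻ q : E3 × E3, ENNReal.ofReal (‖q.2‖ ^ b * S.f τ q.1 q.2) :=
          mul_le_mul_right (hlint _ (ENNReal.continuous_ofReal.comp hgc)) _
      _ = ENNReal.ofReal (K * J) := by
          rw [← ofReal_integral_eq_lintegral_ofReal hgi (ae_of_all _ fun q =>
            mul_nonneg (Real.rpow_nonneg (norm_nonneg _) _) (S.f_nonneg _ _ _)),
            ENNReal.ofReal_mul hK0.le]
  rw [eLpNorm_eq_lintegral_rpow_enorm_toReal (by simpa using hp0) ENNReal.ofReal_ne_top,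
    ENNReal.toReal_ofReal hp0.le]
  refine (ENNReal.rpow_le_rpow hmain (by positivity)).trans_eq ?_
  rw [ENNReal.ofReal_rpow_of_nonneg (by positivity) (by positivity)]
  congr 1
  rw [hK, Real.mul_rpow (by positivity) hJ0, Real.mul_rpow (by positivity) (by positivity),
    ← Real.rpow_mul (by positivity), ← Real.rpow_mul hM.le, mul_one_div_cancel hp0.ne',
    Real.rpow_one, show b / 3 * (1 / p) = b / (3 + b) by rw [hp]; field_simp; ring,
    show 1 / p = 3 / (3 + b) by rw [hp]; field_simp; ring]

end BackwardFlow

/-- Interpolation estimate for the density along the backward flow. -/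
theorem statement_12 :
    ∃ C : ℝ → ℝ,
      (∀ b, 0 < b → 0 < C b) ∧
      ∀ (T : ℝ) (S : VPClassicalSolution T) (c : CutoffData)
        (t : ℝ), t ∈ Icc (0 : ℝ) T →
      ∀ (Φ : BackwardFlow T S c t) (τ s : ℝ),
        τ ∈ Icc (0 : ℝ) t → s ∈ Icc (0 : ℝ) t →
      ∀ b : ℝ, 0 < b →
        eLpNorm (fun x : E3 => ∫ v : E3, S.f τ (Φ.X s x v) (Φ.V s x v))
            (ENNReal.ofReal ((b + 3) / 3)) volume
          ≤ ENNReal.ofReal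
              (C b * (1 + s) ^ (3 * b / (3 + b))
                * supf0 S.f ^ (b / (3 + b))
                * (1 + ∫ p : E3 × E3, ‖p.2‖ ^ b * S.f τ p.1 p.2) ^ (3 / (3 + b))) := by
  have hc := interpConst_nonneg
  refine ⟨fun _ => interpConst + 1, fun _ _ => by linarith, ?_⟩
  intro T S c t ht Φ τ s hτ hs b hb
  refine (Φ.eLpNorm_density_le ht hτ hs hb).trans (ENNReal.ofReal_le_ofReal ?_)
  have hM := S.supf0_nonneg
  have hJ : 0 ≤ ∫ p : E3 × E3, ‖p.2‖ ^ b * S.f τ p.1 p.2 := integral_nonneg fun p =>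
    mul_nonneg (Real.rpow_nonneg (norm_nonneg _) _) (S.f_nonneg _ _ _)
  have h1 : 1 ≤ (1 + s) ^ (3 * b / (3 + b)) :=
    Real.one_le_rpow (by linarith [hs.1]) (by positivity)
  have h2 : interpConst + 1 ≤ (interpConst + 1) * (1 + s) ^ (3 * b / (3 + b)) :=
    le_mul_of_one_le_right (by linarith) h1
  gcongr
  linarith

end
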